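/- Let μ be a shift-invariant probability measure on Ω = {0,1}^(ℤ^d) with μ({ω : 0 ∈ ω}) > 0, and let Ξ assign to each ω ∈ Ω a finite subset Ξ(ω) ⊆ ω, measurably (the set {(ω, x) : x ∈ Ξ(ω)} is measurable for the product σ-algebra) and equivariantly (Ξ(θ_t ω) = Ξ(ω) − t for all t ∈ ℤ^d and all ω). Then Ξ(ω) = ∅ for μ-almost every ω. In other words, one cannot choose a finite non-empty subset of a stationary point process on the grid in a flow-adapted manner. -/

import Mathlib

open Function Set MeasureTheory ProbabilityTheory
open scoped ENNReal NNReal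

namespace PointShift

/-- Points of the grid `ℤ^d`. -/
abbrev Pt (d : ℕ) := Fin d → ℤ

/-- Configurations: subsets of the grid `ℤ^d`, identified with `{0,1}`-valued
functions, equipped with the product σ-algebra. -/
abbrev Conf (d : ℕ) := Pt d → Bool

/-- The shift `θ_t ω = ω - t`. -/
def shift {d : ℕ} (t : Pt d) (ω : Conf d) : Conf d := fun x => ω (x + t)

/-- The support of a configuration, as a subset of `ℤ^d`. -/
def pts {d : ℕ} (ω : Conf d) : Set (Pt d) := {x | ω x = true}

/-- `g` is a point-map: it is measurable and selects a point of every
configuration having a point at the origin. -/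
def IsPointMap {d : ℕ} (g : Conf d → Pt d) : Prop :=
  Measurable g ∧ ∀ ω : Conf d, ω 0 = true → ω (g ω) = true

/-- The point-shift associated with a point-map `g`: `F_ω x = x + g (θ_x ω)`. -/
def Fps {d : ℕ} (g : Conf d → Pt d) (ω : Conf d) (x : Pt d) : Pt d :=
  x + g (shift x ω)

/-- `μ` is a stationary point process on the grid: a shift-invariant probability
measure with a point at the origin with positive probability. -/
def IsStationaryPP {d : ℕ} (μ : Measure (Conf d)) : Prop :=
  IsProbabilityMeasure μ ∧ (∀ t : Pt d, μ.map (shift t) = μ) ∧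
    0 < μ {ω : Conf d | ω 0 = true}

/-- The Palm probability of `μ`: `μ` conditioned on having a point at the origin. -/
noncomputable def Palm {d : ℕ} (μ : Measure (Conf d)) : Measure (Conf d) :=
  μ[|{ω : Conf d | ω 0 = true}]

/-- The foil of the point `x` in the configuration `ω`, for the point-shift of `g`. -/
def foilOn {d : ℕ} (g : Conf d → Pt d) (ω : Conf d) (x : Pt d) : Set (Pt d) :=
  {y | ω y = true ∧ ∃ n : ℕ, (Fps g ω)^[n] y = (Fps g ω)^[n] x}

/-- The connected component of the point `x` in the functional graph `G^F(ω)`. -/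
def compOn {d : ℕ} (g : Conf d → Pt d) (ω : Conf d) (x : Pt d) : Set (Pt d) :=
  {y | ω y = true ∧ ∃ m n : ℕ, (Fps g ω)^[m] x = (Fps g ω)^[n] y}

/-- `K` is a directed cycle of the functional graph of `f`: a finite set of
distinct points `c 0, …, c (k-1)` (with `k ≥ 1`) such that `f (c i) = c ((i+1) % k)`. -/
def IsCycle {X : Type*} (f : X → X) (K : Set X) : Prop :=
  ∃ (k : ℕ) (c : ℕ → X), 0 < k ∧
    (∀ i < k, ∀ j < k, c i = c j → i = j) ∧
    (∀ i < k, f (c i) = c ((i + 1) % k)) ∧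
    K = c '' {i | i < k}

end PointShift

namespace PointShift

theorem measurable_shift {d : ℕ} (t : Pt d) : Measurable (shift t) :=
  measurable_pi_lambda _ fun x => measurable_pi_apply (x + t)

theorem shift_iterate {d : ℕ} (t : Pt d) (n : ℕ) (ω : Conf d) :
    (shift t)^[n] ω = shift (n • t) ω := by
  induction n with
  | zero => funext x; simp [shift]
  | succ n ih =>
    rw [iterate_succ_apply', ih]
    funext x
    simp only [shift, succ_nsmul', add_assoc]

end PointShift

/-- One cannot choose, in a measurable and flow-adapted way, a finite
nonempty subset of a stationary point process on the grid: if `Ξ` selects measurably and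
equivariantly a finite subset `Ξ ω ⊆ ω`, then `Ξ ω = ∅` for `μ`-almost every `ω`. -/
theorem stmt_5 {d : ℕ} (hd : 0 < d)
    (μ : Measure (PointShift.Conf d)) [IsProbabilityMeasure μ]
    (hinv : ∀ t : PointShift.Pt d, μ.map (PointShift.shift t) = μ)
    (hpos : 0 < μ {ω : PointShift.Conf d | ω 0 = true})
    (Ξ : PointShift.Conf d → Set (PointShift.Pt d))
    (hmeas : MeasurableSet {p : PointShift.Conf d × PointShift.Pt d | p.2 ∈ Ξ p.1})
    (hequiv : ∀ (t : PointShift.Pt d) (ω : PointShift.Conf d),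
      Ξ (PointShift.shift t ω) = (fun x => x - t) '' Ξ ω)
    (hsub : ∀ ω : PointShift.Conf d, Ξ ω ⊆ PointShift.pts ω)
    (hfin : ∀ ω : PointShift.Conf d, (Ξ ω).Finite) :
    ∀ᵐ ω ∂μ, Ξ ω = ∅ := by
  let t : PointShift.Pt d := fun _ => 1
  have ht : Injective fun n : ℕ => n • t := by
    intro m n h
    simpa [t] using congrFun h ⟨0, hd⟩
  have hcons : Conservative (PointShift.shift t) μ :=
    MeasurePreserving.conservative ⟨PointShift.measurable_shift t, hinv t⟩
  have hnot (x : PointShift.Pt d) : ∀ᵐ ω ∂μ, x ∉ Ξ ω := by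
    have hA : MeasurableSet {ω | x ∈ Ξ ω} := measurable_prodMk_right hmeas
    filter_upwards [hcons.ae_mem_imp_frequently_image_mem hA.nullMeasurableSet] with ω hω hx
    refine Nat.frequently_atTop_iff_infinite.mp (hω hx) ?_
    refine ((hfin ω).preimage ((add_right_injective x).comp ht).injOn).subset fun n hn => ?_
    simp only [mem_ofPred_eq, PointShift.shift_iterate, hequiv] at hn
    obtain ⟨y, hy, rfl⟩ := hn
    simpa using hy
  filter_upwards [ae_all_iff.mpr hnot] with ω hω
  exact eq_empty_of_forall_notMem hω
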